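/- Assume q ≥ m and let α ∈ Z^m with ℓ(D_α) > 0. Then ⌊D_α⌋_Q = D_{lub(Γ̂_Q(α))}, i.e., the supported floor of D_α at Q is the divisor associated with the least upper bound of the set of absolute maximal elements of Ĥ(Q) that are ≤ α. -/

import Mathlib

open scoped Classical

/-- Abstract divisor-theoretic data of a nonsingular, projective, geometrically
irreducible algebraic curve over a field `Fq`: a function field `K`, a set of
closed points with their degrees, a genus, and the normalized discrete
valuations of `K` at the closed points (with the junk convention `v P 0 = 0`). -/
structure Curve (Fq : Type) [Field Fq] where
  /-- the function field of the curve -/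
  K : Type
  [fieldK : Field K]
  [algebraK : Algebra Fq K]
  /-- the closed points of the curve -/
  Point : Type
  /-- the degree of a closed point -/
  deg : Point → ℕ
  deg_pos : ∀ P, 0 < deg P
  /-- the genus of the curve -/
  genus : ℕ
  /-- the normalized discrete valuation at a closed point -/
  v : Point → K → ℤ
  v_zero : ∀ P, v P 0 = 0
  v_mul : ∀ (P : Point) {x y : K}, x ≠ 0 → y ≠ 0 → v P (x * y) = v P x + v P y
  v_min_le_add : ∀ (P : Point) {x y : K}, x ≠ 0 → y ≠ 0 → x + y ≠ 0 →
    min (v P x) (v P y) ≤ v P (x + y)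
  v_algebraMap : ∀ (P : Point) (c : Fq), c ≠ 0 → v P (algebraMap Fq K c) = 0
  v_surjective : ∀ P : Point, ∃ x : K, x ≠ 0 ∧ v P x = 1
  /-- a nonzero function has only finitely many zeros and poles -/
  support_finite : ∀ {x : K}, x ≠ 0 → {P : Point | v P x ≠ 0}.Finite
  /-- a function without poles is constant (the curve is projective and
  geometrically irreducible) -/
  no_pole_constant : ∀ {x : K}, x ≠ 0 → (∀ P, 0 ≤ v P x) → ∃ c : Fq, x = algebraMap Fq K c
  /-- principal divisors have degree zero -/
  degree_principal : ∀ {x : K}, x ≠ 0 → ∑ᶠ P : Point, (deg P : ℤ) * v P x = 0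

attribute [instance] Curve.fieldK Curve.algebraK

namespace Curve

variable {Fq : Type} [Field Fq] [Fintype Fq]

/-- The degree of a divisor. -/
noncomputable def degDiv (C : Curve Fq) (D : C.Point →₀ ℤ) : ℤ :=
  D.sum fun P n => (C.deg P : ℤ) * n

/-- The Riemann–Roch space `L(D)`. -/
def Lset (C : Curve Fq) (D : C.Point →₀ ℤ) : Set C.K :=
  {h | h = 0 ∨ ∀ P : C.Point, 0 ≤ C.v P h + D P}

/-- `ℓ(D)`, the dimension of `L(D)` as an `Fq`-vector space. -/
noncomputable def ell (C : Curve Fq) (D : C.Point →₀ ℤ) : ℕ :=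
  Module.finrank Fq (Submodule.span Fq (C.Lset D))

/-- The divisor `D` is principal. -/
def IsPrincipalDiv (C : Curve Fq) (D : C.Point →₀ ℤ) : Prop :=
  ∃ h : C.K, h ≠ 0 ∧ ∀ P : C.Point, C.v P h = D P

/-- The divisor `D_α = α₁Q₁ + ⋯ + α_mQ_m`. -/
noncomputable def Dt (C : Curve Fq) {m : ℕ} (Q : Fin m → C.Point) (α : Fin m → ℤ) :
    C.Point →₀ ℤ :=
  ∑ i, Finsupp.single (Q i) (α i)

/-- The generalized Weierstrass semigroup `Ĥ(Q)`: the set of tuples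
`(-v_{Q_1}(h), …, -v_{Q_m}(h))` for nonzero `h` having poles only in `{Q_1, …, Q_m}`. -/
def Hhat (C : Curve Fq) {m : ℕ} (Q : Fin m → C.Point) : Set (Fin m → ℤ) :=
  {α | ∃ h : C.K, h ≠ 0 ∧ (∀ P : C.Point, P ∉ Set.range Q → 0 ≤ C.v P h) ∧
    ∀ i, α i = -C.v (Q i) h}

/-- `∇_J(α)`. -/
def nabla (C : Curve Fq) {m : ℕ} (Q : Fin m → C.Point) (J : Set (Fin m))
    (α : Fin m → ℤ) : Set (Fin m → ℤ) :=
  {β | β ∈ C.Hhat Q ∧ (∀ j ∈ J, β j = α j) ∧ ∀ i ∉ J, β i < α i}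

/-- `∇_i^m(α)`. -/
def nablaI (C : Curve Fq) {m : ℕ} (Q : Fin m → C.Point) (i : Fin m) (α : Fin m → ℤ) :
    Set (Fin m → ℤ) :=
  {β | β ∈ C.Hhat Q ∧ β i = α i ∧ ∀ j, j ≠ i → β j ≤ α j}

/-- `Γ̂(Q)`, the set of absolute maximal elements of `Ĥ(Q)`. -/
def Gammahat (C : Curve Fq) {m : ℕ} (Q : Fin m → C.Point) : Set (Fin m → ℤ) :=
  {α | α ∈ C.Hhat Q ∧
    ∀ J : Set (Fin m), J.Nonempty → J ≠ Set.univ → C.nabla Q J α = ∅}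

/-- `Γ̂_Q(α) = {β ∈ Γ̂(Q) : β ≤ α}`. -/
def GammahatLe (C : Curve Fq) {m : ℕ} (Q : Fin m → C.Point) (α : Fin m → ℤ) :
    Set (Fin m → ℤ) :=
  {β | β ∈ C.Gammahat Q ∧ ∀ i, β i ≤ α i}

/-- The divisor `A` is a discrepancy with respect to `P` and `Q'`. -/
def IsDiscrepancy (C : Curve Fq) (A : C.Point →₀ ℤ) (P Q' : C.Point) : Prop :=
  C.Lset A ≠ C.Lset (A - Finsupp.single Q' 1) ∧
  C.Lset (A - Finsupp.single P 1) = C.Lset (A - Finsupp.single P 1 - Finsupp.single Q' 1)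

/-- `T_α = {β ∈ ℤ^m : β ≤ α and ℓ(D_β) = ℓ(D_α)}`. -/
def Tset (C : Curve Fq) {m : ℕ} (Q : Fin m → C.Point) (α : Fin m → ℤ) :
    Set (Fin m → ℤ) :=
  {β | (∀ j, β j ≤ α j) ∧ C.ell (C.Dt Q β) = C.ell (C.Dt Q α)}

/-- `D_β` is the supported floor `⌊D_α⌋_Q`: `β` is the element of `T_α` of minimum
norm `|β| = β₁ + ⋯ + β_m`. -/
def IsSuppFloor (C : Curve Fq) {m : ℕ} (Q : Fin m → C.Point) (α β : Fin m → ℤ) : Prop :=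
  β ∈ C.Tset Q α ∧ ∀ γ ∈ C.Tset Q α, ∑ i, β i ≤ ∑ i, γ i

/-- `G'` is the floor `⌊G⌋` of `G`: among all divisors with the same Riemann–Roch
space as `G`, it has minimum degree. -/
def IsFloorDiv (C : Curve Fq) (G G' : C.Point →₀ ℤ) : Prop :=
  C.Lset G' = C.Lset G ∧
  ∀ G'' : C.Point →₀ ℤ, C.Lset G'' = C.Lset G → C.degDiv G' ≤ C.degDiv G''

end Curve

namespace Curve

variable {Fq : Type} [Field Fq] (C : Curve Fq)

theorem v_smul (P : C.Point) {c : Fq} (hc : c ≠ 0) {x : C.K} (hx : x ≠ 0) :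
    C.v P (c • x) = C.v P x := by
  rw [Algebra.smul_def, C.v_mul P (by simpa using hc) hx, C.v_algebraMap P c hc, zero_add]

/-- Subtracting a function of larger valuation neither kills `x` nor raises its valuation. -/
theorem sub_ne_zero_and_v_sub_le (P : C.Point) {x y : C.K} (hx : x ≠ 0)
    (hxy : y = 0 ∨ C.v P x < C.v P y) : x - y ≠ 0 ∧ C.v P (x - y) ≤ C.v P x := by
  rcases eq_or_ne y 0 with rfl | hy
  · simpa using hx
  have hlt : C.v P x < C.v P y := hxy.resolve_left hy
  have hne : x - y ≠ 0 := by
    intro h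
    rw [sub_eq_zero.mp h] at hlt
    exact lt_irrefl _ hlt
  refine ⟨hne, ?_⟩
  have h := C.v_min_le_add P hne hy (by simpa using hx)
  rw [sub_add_cancel] at h
  rcases min_le_iff.mp h with h | h <;> omega

/-- The Riemann–Roch space `L(D)` as a subspace of the function field. -/
def riemannRochSpace (D : C.Point →₀ ℤ) : Submodule Fq C.K where
  carrier := C.Lset D
  zero_mem' := Or.inl rfl
  add_mem' := by
    intro x y hx hy
    rcases eq_or_ne x 0 with rfl | hx0
    · simpa using hy
    rcases eq_or_ne y 0 with rfl | hy0
    · simpa using hx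
    rcases eq_or_ne (x + y) 0 with h0 | h0
    · exact Or.inl h0
    refine Or.inr fun P => ?_
    have h := C.v_min_le_add P hx0 hy0 h0
    have h1 := hx.resolve_left hx0 P
    have h2 := hy.resolve_left hy0 P
    rcases min_le_iff.mp h with h | h <;> omega
  smul_mem' := by
    intro c x hx
    rcases eq_or_ne c 0 with rfl | hc
    · exact Or.inl (zero_smul _ _)
    rcases eq_or_ne x 0 with rfl | hx0
    · exact Or.inl (smul_zero _)
    refine Or.inr fun P => ?_
    rw [C.v_smul P hc hx0]
    exact hx.resolve_left hx0 P

theorem mem_riemannRochSpace {D : C.Point →₀ ℤ} {h : C.K} (hh : h ≠ 0) :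
    h ∈ C.riemannRochSpace D ↔ ∀ P, 0 ≤ C.v P h + D P :=
  or_iff_right hh

theorem riemannRochSpace_mono {D E : C.Point →₀ ℤ} (hDE : D ≤ E) :
    C.riemannRochSpace D ≤ C.riemannRochSpace E := by
  rintro h (rfl | hh)
  · exact zero_mem _
  · exact Or.inr fun P => (hh P).trans (by linarith [hDE P])

theorem ell_eq_finrank (D : C.Point →₀ ℤ) :
    C.ell D = Module.finrank Fq (C.riemannRochSpace D) := by
  change Module.finrank Fq (Submodule.span Fq (C.riemannRochSpace D : Set C.K)) = _
  rw [Submodule.span_eq]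

theorem degDiv_add (D E : C.Point →₀ ℤ) : C.degDiv (D + E) = C.degDiv D + C.degDiv E :=
  Finsupp.sum_add_index' (fun _ => mul_zero _) fun _ _ _ => mul_add _ _ _

theorem degDiv_sub (D E : C.Point →₀ ℤ) : C.degDiv (D - E) = C.degDiv D - C.degDiv E := by
  have h := C.degDiv_add (D - E) E
  rw [sub_add_cancel] at h
  omega

theorem degDiv_single (P : C.Point) (n : ℤ) :
    C.degDiv (Finsupp.single P n) = C.deg P * n :=
  Finsupp.sum_single_index (mul_zero _)

theorem riemannRochSpace_eq_bot {D : C.Point →₀ ℤ} (hD : C.degDiv D < 0) :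
    C.riemannRochSpace D = ⊥ := by
  rw [eq_bot_iff]
  intro h hh
  by_contra h0
  have h0 : h ≠ 0 := h0
  rw [C.mem_riemannRochSpace h0] at hh
  have hdeg : C.degDiv D = ∑ᶠ P, (C.deg P : ℤ) * D P := by
    refine (finsum_eq_sum_of_support_subset _ fun P hP => ?_).symm
    simp only [Function.mem_support] at hP
    simpa using right_ne_zero_of_mul hP
  have hadd := finsum_add_distrib (f := fun P => (C.deg P : ℤ) * C.v P h)
    (g := fun P => (C.deg P : ℤ) * D P)
    ((C.support_finite h0).subset fun P hP => right_ne_zero_of_mul hP)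
    (D.support.finite_toSet.subset fun P hP => by simpa using right_ne_zero_of_mul hP)
  rw [C.degree_principal h0, ← hdeg, zero_add] at hadd
  have : 0 ≤ C.degDiv D := by
    rw [← hadd]
    refine finsum_nonneg fun P => ?_
    rw [← mul_add]
    exact mul_nonneg (Int.natCast_nonneg _) (hh P)
  omega

theorem finiteDimensional_riemannRochSpace {C : Curve Fq} {K₀ : C.Point →₀ ℤ}
    (hRR : ∀ D : C.Point →₀ ℤ,
      (C.ell D : ℤ) - C.ell (K₀ - D) = C.degDiv D + 1 - C.genus)
    {P : C.Point} (hP : C.deg P = 1) (D : C.Point →₀ ℤ) :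
    FiniteDimensional Fq (C.riemannRochSpace D) := by
  obtain ⟨n, hn⟩ : ∃ n : ℕ, C.degDiv K₀ - C.degDiv D < n ∧ C.genus - C.degDiv D < n := by
    refine ⟨(C.degDiv K₀ - C.degDiv D).natAbs + (C.genus - C.degDiv D).natAbs + 1, ?_, ?_⟩ <;> omega
  set E := D + Finsupp.single P (n : ℤ) with hE
  have hdegE : C.degDiv E = C.degDiv D + n := by
    rw [hE, C.degDiv_add, C.degDiv_single, hP, Nat.cast_one, one_mul]
  have hK : C.ell (K₀ - E) = 0 := by
    rw [ell_eq_finrank, C.riemannRochSpace_eq_bot, finrank_bot]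
    rw [C.degDiv_sub]
    omega
  have hpos : 0 < Module.finrank Fq (C.riemannRochSpace E) := by
    rw [← ell_eq_finrank]
    have := hRR E
    omega
  have : FiniteDimensional Fq (C.riemannRochSpace E) := Module.finite_of_finrank_pos hpos
  refine Submodule.finiteDimensional_of_le (C.riemannRochSpace_mono (E := E) ?_)
  exact le_add_of_nonneg_right (Finsupp.single_nonneg.mpr (Int.natCast_nonneg n))

theorem ell_add_single_le {C : Curve Fq} {K₀ : C.Point →₀ ℤ}
    (hRR : ∀ D : C.Point →₀ ℤ,
      (C.ell D : ℤ) - C.ell (K₀ - D) = C.degDiv D + 1 - C.genus)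
    {P : C.Point} (hP : C.deg P = 1) (D : C.Point →₀ ℤ) :
    C.ell (D + Finsupp.single P 1) ≤ C.ell D + 1 := by
  have h1 := hRR D
  have h2 := hRR (D + Finsupp.single P 1)
  have := finiteDimensional_riemannRochSpace hRR hP (K₀ - D)
  have h3 : C.ell (K₀ - (D + Finsupp.single P 1)) ≤ C.ell (K₀ - D) := by
    rw [ell_eq_finrank, ell_eq_finrank]
    refine Submodule.finrank_mono (C.riemannRochSpace_mono (sub_le_sub_left ?_ _))
    exact le_add_of_nonneg_right (Finsupp.single_nonneg.mpr zero_le_one)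
  rw [C.degDiv_add, C.degDiv_single, hP] at h2
  push_cast at h2
  omega

/-- A pole at a rational point can be reduced by subtracting a multiple of any function with a
pole of the same order. -/
theorem exists_sub_smul_mem {C : Curve Fq} {K₀ : C.Point →₀ ℤ}
    (hRR : ∀ D : C.Point →₀ ℤ,
      (C.ell D : ℤ) - C.ell (K₀ - D) = C.degDiv D + 1 - C.genus)
    {P : C.Point} (hP : C.deg P = 1) {D : C.Point →₀ ℤ} {f g : C.K}
    (hf : f ∈ C.riemannRochSpace D) (hg : g ∈ C.riemannRochSpace D)
    (hgP : g ∉ C.riemannRochSpace (D - Finsupp.single P 1)) :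
    ∃ c : Fq, f - c • g ∈ C.riemannRochSpace (D - Finsupp.single P 1) := by
  set E := D - Finsupp.single P 1 with hE
  have := finiteDimensional_riemannRochSpace hRR hP D
  have := finiteDimensional_riemannRochSpace hRR hP E
  have hED : C.riemannRochSpace E ≤ C.riemannRochSpace D :=
    C.riemannRochSpace_mono (sub_le_self _ (Finsupp.single_nonneg.mpr zero_le_one))
  have hlt : C.riemannRochSpace E < C.riemannRochSpace E ⊔ Submodule.span Fq {g} :=
    lt_of_le_of_ne le_sup_left fun h =>
      hgP (h ▸ Submodule.mem_sup_right (Submodule.mem_span_singleton_self g))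
  have hle : C.riemannRochSpace E ⊔ Submodule.span Fq {g} ≤ C.riemannRochSpace D :=
    sup_le hED ((Submodule.span_singleton_le_iff_mem _ _).mpr hg)
  have hrank := Submodule.finrank_lt_finrank_of_lt hlt
  have hell := ell_add_single_le hRR hP E
  rw [hE, sub_add_cancel, ← hE, ell_eq_finrank, ell_eq_finrank] at hell
  rw [← Submodule.eq_of_le_of_finrank_le hle (by omega)] at hf
  obtain ⟨e, he, _, hy, rfl⟩ := Submodule.mem_sup.mp hf
  obtain ⟨c, rfl⟩ := Submodule.mem_span_singleton.mp hy
  exact ⟨c, by simpa using he⟩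

variable {m : ℕ} {Q : Fin m → C.Point}

theorem Dt_apply_of_notMem_range {P : C.Point} (hP : P ∉ Set.range Q) (α : Fin m → ℤ) :
    C.Dt Q α P = 0 := by
  rw [Dt, Finsupp.finsetSum_apply]
  exact Finset.sum_eq_zero fun i _ =>
    Finsupp.single_eq_of_ne fun h => hP ⟨i, h.symm⟩

theorem Dt_apply (hQ : Function.Injective Q) (α : Fin m → ℤ) (i : Fin m) :
    C.Dt Q α (Q i) = α i := by
  rw [Dt, Finsupp.finsetSum_apply, Finset.sum_eq_single i]
  · exact Finsupp.single_eq_same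
  · exact fun j _ hj => Finsupp.single_eq_of_ne fun h => hj (hQ h.symm)
  · simp

theorem mem_riemannRochSpace_Dt (hQ : Function.Injective Q) {α : Fin m → ℤ} {h : C.K}
    (hh : h ≠ 0) :
    h ∈ C.riemannRochSpace (C.Dt Q α) ↔
      (∀ P, P ∉ Set.range Q → 0 ≤ C.v P h) ∧ ∀ i, -C.v (Q i) h ≤ α i := by
  rw [C.mem_riemannRochSpace hh]
  constructor
  · refine fun H => ⟨fun P hP => ?_, fun i => ?_⟩
    · simpa [C.Dt_apply_of_notMem_range hP] using H P
    · have := H (Q i)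
      rw [C.Dt_apply hQ] at this
      omega
  · rintro ⟨h1, h2⟩ P
    by_cases hP : P ∈ Set.range Q
    · obtain ⟨i, rfl⟩ := hP
      rw [C.Dt_apply hQ]
      have := h2 i
      omega
    · simpa [C.Dt_apply_of_notMem_range hP] using h1 P hP

theorem Dt_mono (hQ : Function.Injective Q) {α β : Fin m → ℤ} (h : β ≤ α) :
    C.Dt Q β ≤ C.Dt Q α := by
  intro P
  by_cases hP : P ∈ Set.range Q
  · obtain ⟨i, rfl⟩ := hP
    simpa only [C.Dt_apply hQ] using h i
  · simp only [C.Dt_apply_of_notMem_range hP, le_refl]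

/-- Each pole order at `Q i` that is largest possible in `L(D_α)` is attained by an absolute
maximal element below `α`. -/
theorem exists_mem_GammahatLe [Fintype Fq] {C : Curve Fq} {K₀ : C.Point →₀ ℤ}
    (hRR : ∀ D : C.Point →₀ ℤ,
      (C.ell D : ℤ) - C.ell (K₀ - D) = C.degDiv D + 1 - C.genus)
    {m : ℕ} {Q : Fin m → C.Point}
    (hQ : Function.Injective Q) (hdeg : ∀ i, C.deg (Q i) = 1)
    {α : Fin m → ℤ} (hα : 0 < C.ell (C.Dt Q α)) (i : Fin m) :
    ∃ β ∈ C.GammahatLe Q α, ∀ h ∈ C.riemannRochSpace (C.Dt Q α), h ≠ 0 →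
      -C.v (Q i) h ≤ β i := by
  set L := C.riemannRochSpace (C.Dt Q α) with hL
  have hfd : FiniteDimensional Fq L := finiteDimensional_riemannRochSpace hRR (hdeg i) _
  have : Finite L := Module.finite_of_finite Fq
  have hfin : (L : Set C.K).Finite := Set.toFinite _
  obtain ⟨h₀, hh₀L, hh₀⟩ : ∃ h ∈ L, h ≠ 0 := by
    refine (Submodule.ne_bot_iff _).mp fun h => ?_
    rw [ell_eq_finrank, ← hL, h, finrank_bot] at hα
    exact lt_irrefl _ hα
  obtain ⟨w, ⟨hwL, hw⟩, hwmin⟩ := Set.exists_min_image {h | h ∈ L ∧ h ≠ 0}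
    (fun h => C.v (Q i) h) (hfin.subset fun _ h => h.1) ⟨h₀, hh₀L, hh₀⟩
  obtain ⟨f, ⟨hfL, hf, hfw⟩, hfmin⟩ := Set.exists_max_image
    {h | h ∈ L ∧ h ≠ 0 ∧ C.v (Q i) h ≤ C.v (Q i) w}
    (fun h => ∑ j, C.v (Q j) h) (hfin.subset fun _ h => h.1) ⟨w, hwL, hw, le_rfl⟩
  have hfpole := (C.mem_riemannRochSpace_Dt hQ hf).mp hfL
  refine ⟨fun j => -C.v (Q j) f, ⟨⟨⟨f, hf, hfpole.1, fun _ => rfl⟩, ?_⟩, hfpole.2⟩,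
    fun h hhL hh => ?_⟩
  swap
  · have : C.v (Q i) w ≤ C.v (Q i) h := hwmin h ⟨hhL, hh⟩
    change -C.v (Q i) h ≤ -C.v (Q i) f
    omega
  have key : ∀ h : C.K, h ∈ C.riemannRochSpace (C.Dt Q fun j => -C.v (Q j) f) → h ≠ 0 →
      C.v (Q i) h ≤ C.v (Q i) f → ∀ j, C.v (Q j) h = C.v (Q j) f := by
    intro h hhf hh hi
    have hle : ∀ j, C.v (Q j) f ≤ C.v (Q j) h := fun j => by
      have := ((C.mem_riemannRochSpace_Dt hQ hh).mp hhf).2 j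
      omega
    have hsum := hfmin h ⟨C.riemannRochSpace_mono (C.Dt_mono hQ hfpole.2) hhf, hh, hi.trans hfw⟩
    have := (Finset.sum_eq_sum_iff_of_le fun j _ => hle j).mp
      (le_antisymm (Finset.sum_le_sum fun j _ => hle j) hsum)
    exact fun j => (this j (Finset.mem_univ j)).symm
  intro J hJ hJu
  rw [Set.eq_empty_iff_forall_notMem]
  rintro δ ⟨⟨g, hg, hgreg, hgδ⟩, hδJ, hδJc⟩
  have hgf : g ∈ C.riemannRochSpace (C.Dt Q fun j => -C.v (Q j) f) := by
    refine (C.mem_riemannRochSpace_Dt hQ hg).mpr ⟨hgreg, fun j => ?_⟩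
    rw [← hgδ]
    by_cases hj : j ∈ J
    · exact (hδJ j hj).le
    · exact (hδJc j hj).le
  by_cases hi : i ∈ J
  · obtain ⟨k, hk⟩ := (Set.ne_univ_iff_exists_notMem J).mp hJu
    have h1 : δ i = -C.v (Q i) f := hδJ i hi
    have h2 : δ k < -C.v (Q k) f := hδJc k hk
    rw [hgδ] at h1 h2
    have := key g hgf hg (by omega) k
    omega
  · obtain ⟨j, hj⟩ := hJ
    have hgj : δ j = -C.v (Q j) f := hδJ j hj
    have hgi : δ i < -C.v (Q i) f := hδJc i hi
    rw [hgδ] at hgj hgi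
    have hff : f ∈ C.riemannRochSpace (C.Dt Q fun j => -C.v (Q j) f) :=
      (C.mem_riemannRochSpace_Dt hQ hf).mpr ⟨hfpole.1, fun _ => le_rfl⟩
    obtain ⟨c, hc⟩ := exists_sub_smul_mem hRR (hdeg j) hff hgf (by
      rw [C.mem_riemannRochSpace hg]
      intro h
      have := h (Q j)
      rw [Finsupp.sub_apply, C.Dt_apply hQ, Finsupp.single_eq_same] at this
      omega)
    obtain ⟨hne, hle⟩ := C.sub_ne_zero_and_v_sub_le (Q i) (y := c • g) hf (by
      rcases eq_or_ne c 0 with rfl | hc0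
      · exact Or.inl (zero_smul _ _)
      · right
        rw [C.v_smul _ hc0 hg]
        omega)
    have h1 := key _ (sub_mem hff (Submodule.smul_mem _ c hgf)) hne hle j
    have h2 := (C.mem_riemannRochSpace hne).mp hc (Q j)
    rw [Finsupp.sub_apply, C.Dt_apply hQ, Finsupp.single_eq_same] at h2
    omega

end Curve

/-- Theorem 3.6: assume `q ≥ m` and `ℓ(D_α) > 0`.  Then
`⌊D_α⌋_Q = D_{lub(Γ̂_Q(α))}`, the divisor associated with the componentwise least
upper bound of the absolute maximal elements of `Ĥ(Q)` that are `≤ α`. -/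
theorem statement5 {Fq : Type} [Field Fq] [Fintype Fq] (C : Curve Fq)
    (hgenus : 0 < C.genus) (K₀ : C.Point →₀ ℤ)
    (hRR : ∀ D : C.Point →₀ ℤ,
      (C.ell D : ℤ) - C.ell (K₀ - D) = C.degDiv D + 1 - C.genus)
    {m : ℕ} (hm : 2 ≤ m) (Q : Fin m → C.Point)
    (hQinj : Function.Injective Q) (hQdeg : ∀ i, C.deg (Q i) = 1)
    (hq : m ≤ Fintype.card Fq)
    (α : Fin m → ℤ) (hα : 0 < C.ell (C.Dt Q α)) :
    C.IsSuppFloor Q α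
      (fun i => sSup ((fun β : Fin m → ℤ => β i) '' C.GammahatLe Q α)) := by
  set γ : Fin m → ℤ :=
    fun i => sSup ((fun β : Fin m → ℤ => β i) '' C.GammahatLe Q α) with hγ
  have hmax : ∀ i, ∃ β ∈ C.GammahatLe Q α, β i = γ i ∧
      ∀ h ∈ C.riemannRochSpace (C.Dt Q α), h ≠ 0 → -C.v (Q i) h ≤ γ i := by
    intro i
    obtain ⟨β, hβ, hβmax⟩ := Curve.exists_mem_GammahatLe hRR hQinj hQdeg hα i
    have hgreatest : IsGreatest ((fun β : Fin m → ℤ => β i) '' C.GammahatLe Q α) (β i) := by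
      refine ⟨⟨β, hβ, rfl⟩, ?_⟩
      rintro _ ⟨δ, ⟨⟨⟨h, hh, hreg, hδ⟩, -⟩, hδα⟩, rfl⟩
      have := hβmax h ((C.mem_riemannRochSpace_Dt hQinj hh).mpr
        ⟨hreg, fun j => hδ j ▸ hδα j⟩) hh
      exact (hδ i).trans_le this
    have hγi : γ i = β i := hgreatest.csSup_eq
    exact ⟨β, hβ, hγi.symm, fun h hhL hh => hγi ▸ hβmax h hhL hh⟩
  have hγα : γ ≤ α := by
    intro i
    obtain ⟨β, hβ, hβγ, -⟩ := hmax i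
    exact hβγ ▸ hβ.2 i
  refine ⟨⟨hγα, ?_⟩, ?_⟩
  · rw [C.ell_eq_finrank, C.ell_eq_finrank]
    suffices C.riemannRochSpace (C.Dt Q γ) = C.riemannRochSpace (C.Dt Q α) by rw [this]
    refine le_antisymm (C.riemannRochSpace_mono (C.Dt_mono hQinj hγα)) fun h hhL => ?_
    rcases eq_or_ne h 0 with rfl | hh
    · exact zero_mem _
    refine (C.mem_riemannRochSpace_Dt hQinj hh).mpr
      ⟨((C.mem_riemannRochSpace_Dt hQinj hh).mp hhL).1, fun i => ?_⟩
    obtain ⟨-, -, -, hi⟩ := hmax i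
    exact hi h hhL hh
  · rintro δ ⟨hδα, hδ⟩
    rw [C.ell_eq_finrank, C.ell_eq_finrank] at hδ
    refine Finset.sum_le_sum fun i _ => ?_
    have := Curve.finiteDimensional_riemannRochSpace hRR (hQdeg i) (C.Dt Q α)
    have heq := Submodule.eq_of_le_of_finrank_eq
      (C.riemannRochSpace_mono (C.Dt_mono hQinj hδα)) hδ
    obtain ⟨β, ⟨⟨⟨h, hh, hreg, hβ⟩, -⟩, hβα⟩, hβγ, -⟩ := hmax i
    have hhL := (C.mem_riemannRochSpace_Dt hQinj hh).mpr ⟨hreg, fun j => hβ j ▸ hβα j⟩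
    rw [← heq] at hhL
    rw [← hβγ, hβ i]
    exact ((C.mem_riemannRochSpace_Dt hQinj hh).mp hhL).2 i
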